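/- Let p be a complex polynomial of degree d ≥ 2, and let U, V ⊆ ℂ be bounded, connected, simply connected open sets with p⁻¹(V) = U. Then p has exactly d − 1 critical points in U, counted with multiplicity; in particular p has no critical points on ∂U, and no critical values on ∂V. -/

import Mathlib

open Polynomial

section

open Filter Topology Set

theorem IsPreconnected.eq_of_exp_eq_const {X : Type*} [TopologicalSpace X] {S : Set X}
    (hS : IsPreconnected S) {f : X → ℂ} (hf : ContinuousOn f S) {c : ℂ}
    (hc : ∀ x ∈ S, Complex.exp (f x) = c) {x y : X} (hx : x ∈ S) (hy : y ∈ S) : f x = f y := by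
  have hcount : (f '' S).Countable := by
    refine (countable_range fun n : ℤ => f x + n * (2 * Real.pi * Complex.I)).mono ?_
    rintro _ ⟨z, hz, rfl⟩
    obtain ⟨n, hn⟩ := Complex.exp_eq_exp_iff_exists_int.1 ((hc z hz).trans (hc x hx).symm)
    exact ⟨n, hn.symm⟩
  exact hcount.isTotallyDisconnected _ subset_rfl (hS.image f hf)
    (mem_image_of_mem f hx) (mem_image_of_mem f hy)

theorem Complex.not_exists_continuous_log_sphere (w : ℂ) {r : ℝ} (hr : 0 < r) {Λ : ℂ → ℂ}
    (hΛ : Continuous Λ) (h : ∀ z ∈ Metric.sphere w r, Complex.exp (Λ z) = z - w) : False := by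
  have hcm (θ : ℝ) : circleMap w r θ ∈ Metric.sphere w r := circleMap_mem_sphere w hr.le θ
  have key := isPreconnected_univ.eq_of_exp_eq_const (S := (univ : Set ℝ))
    (f := fun θ : ℝ => Λ (circleMap w r θ) - θ * Complex.I) (c := (r : ℂ))
    (by fun_prop) (fun θ _ => by
      rw [Complex.exp_sub, h _ (hcm θ), circleMap]
      field_simp
      ring) (mem_univ 0) (mem_univ (2 * Real.pi))
  have h2 : circleMap w r (2 * Real.pi) = circleMap w r 0 := by
    simpa using (periodic_circleMap w r) 0
  have h3 : (2 * Real.pi : ℂ) * Complex.I = 0 := by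
    simp only [h2] at key
    push_cast at key
    linear_combination key
  simp [Real.pi_ne_zero] at h3

/-- If `z ↦ z - w` has a continuous logarithm on a compact set, then `w` lies in an unbounded
component of its complement. -/
theorem IsCompact.not_isBounded_connectedComponentIn_compl {K : Set ℂ} (hK : IsCompact K) {w : ℂ}
    (hw : w ∉ K) {L : ℂ → ℂ} (hL : ContinuousOn L K)
    (hexp : ∀ z ∈ K, Complex.exp (L z) = z - w) :
    ¬ Bornology.IsBounded (connectedComponentIn Kᶜ w) := by
  classical
  intro hb
  set G := connectedComponentIn Kᶜ w
  have hGo : IsOpen G := hK.isClosed.isOpen_compl.connectedComponentIn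
  have hwG : w ∈ G := mem_connectedComponentIn hw
  have hfr : frontier G ⊆ K := by
    intro z hz
    rw [hGo.frontier_eq] at hz
    by_contra hzK
    have hsub : insert z G ⊆ G := by
      refine IsPreconnected.subset_connectedComponentIn ?_ (mem_insert_of_mem _ hwG) ?_
      · exact isPreconnected_connectedComponentIn.subset_closure (subset_insert _ _)
          (insert_subset hz.1 subset_closure)
      · exact insert_subset hzK (connectedComponentIn_subset _ _)
    exact hz.2 (hsub (mem_insert _ _))
  obtain ⟨g, hg⟩ := ContinuousMap.exists_restrict_eq hK.isClosed
    ⟨K.domRestrict L, continuousOn_iff_continuous_domRestrict.1 hL⟩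
  have hgL : ∀ z ∈ K, g z = L z := fun z hz => DFunLike.congr_fun hg ⟨z, hz⟩
  let H : ℂ → ℂ := G.piecewise (fun z => Complex.exp (g z)) (fun z => z - w)
  have hH : Continuous H := by
    refine Continuous.piecewise (fun z hz => ?_) (by fun_prop) (by fun_prop)
    rw [hgL z (hfr hz), hexp z (hfr hz)]
  have hH0 : (0 : ℂ) ∉ H '' univ := by
    rintro ⟨z, -, hz⟩
    by_cases hzG : z ∈ G
    · simp [H, hzG] at hz
    · simp only [H, hzG, not_false_eq_true, piecewise_eq_of_notMem, sub_eq_zero] at hz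
      exact hzG (hz ▸ hwG)
  have hsc : IsSimplyConnected (univ : Set ℂ) := by
    have : ContractibleSpace (univ : Set ℂ) :=
      convex_univ.contractibleSpace univ_nonempty
    exact SimplyConnectedSpace.ofContractible _
  obtain ⟨Λ, hΛ, hΛe⟩ :=
    Complex.exists_continuousOn_eqOn_exp_comp hsc isOpen_univ hH.continuousOn hH0
  obtain ⟨r, hr⟩ := hb.subset_ball w
  have hr0 : 0 < r := by simpa using hr hwG
  refine Complex.not_exists_continuous_log_sphere w hr0 (continuousOn_univ.1 hΛ) fun z hz => ?_
  have hzG : z ∉ G := fun hzG => (Metric.mem_ball.1 (hr hzG)).ne hz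
  have := hΛe (mem_univ z)
  simpa [H, hzG] using this

theorem IsPathConnected.exists_isCompact_isConnected {X : Type*} [TopologicalSpace X] {U F : Set X}
    (hU : IsPathConnected U) (hF : F.Finite) (hne : F.Nonempty) (hFU : F ⊆ U) :
    ∃ S ⊆ U, F ⊆ S ∧ IsCompact S ∧ IsConnected S := by
  obtain ⟨n, f, hf⟩ := hF.fin_param
  obtain ⟨x, hx⟩ := hne
  cases n with
  | zero =>
    obtain ⟨i, -⟩ := hf.2 ▸ hx
    exact i.elim0
  | succ n =>
    obtain ⟨γ, hγ, hi⟩ := hU.exists_path_through_family f fun i => hFU (hf.2 ▸ mem_range_self i)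
    refine ⟨range γ, hγ, ?_, isCompact_range γ.continuous, isConnected_range γ.continuous⟩
    rw [← hf.2]
    exact range_subset_iff.2 hi

theorem Complex.norm_log_sub_div_sub_le {z a b : ℂ} (h : ‖b - a‖ ≤ ‖z - b‖ / 2) :
    ‖Complex.log ((z - a) / (z - b))‖ ≤ 3 / 2 * (‖b - a‖ / ‖z - b‖) := by
  rcases eq_or_ne z b with rfl | hz
  · simp
  have hz' : 0 < ‖z - b‖ := norm_pos_iff.2 (sub_ne_zero.2 hz)
  have e : (z - a) / (z - b) = 1 + (b - a) / (z - b) := by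
    field_simp [sub_ne_zero.2 hz]
    ring
  rw [e, ← norm_div]
  refine Complex.norm_log_one_add_half_le_self ?_
  rw [norm_div, div_le_iff₀ hz']
  linarith

/-- `z ↦ (z - a) / (z - b)` has a continuous logarithm on `S` whose values at the points of `m`
sum to zero. -/
def HasBalancedLog (S : Set ℂ) (m : Multiset ℂ) (a b : ℂ) : Prop :=
  ∃ L : ℂ → ℂ, ContinuousOn L S ∧ (∀ z ∈ S, Complex.exp (L z) = (z - a) / (z - b)) ∧
    (m.map L).sum = 0

theorem HasBalancedLog.refl {S : Set ℂ} {m : Multiset ℂ} {a : ℂ} (ha : a ∉ S) :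
    HasBalancedLog S m a a :=
  ⟨0, continuousOn_const, fun z hz => by
    have : z - a ≠ 0 := sub_ne_zero.2 (by rintro rfl; exact ha hz)
    simp [this], by simp⟩

theorem Complex.continuousOn_log_sub_div_sub {S : Set ℂ} {a b : ℂ}
    (h : ∀ z ∈ S, z ≠ b ∧ ‖b - a‖ ≤ ‖z - b‖ / 2) :
    ContinuousOn (fun z => Complex.log ((z - a) / (z - b))) S := by
  refine ContinuousOn.clog (ContinuousOn.div (by fun_prop) (by fun_prop) fun z hz =>
    sub_ne_zero.2 (h z hz).1) fun z hz => ?_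
  obtain ⟨hzb, hz⟩ := h z hz
  have hz' : 0 < ‖z - b‖ := norm_pos_iff.2 (sub_ne_zero.2 hzb)
  have e : (z - a) / (z - b) = 1 + (b - a) / (z - b) := by
    field_simp [sub_ne_zero.2 hzb]
    ring
  rw [e]
  refine Complex.mem_slitPlane_of_norm_lt_one ?_
  rw [norm_div, div_lt_one hz']
  linarith

theorem HasBalancedLog.perturb {S : Set ℂ} {m : Multiset ℂ} {a b a' b' : ℂ} {r : ℝ}
    (h : HasBalancedLog S m a b) (hr : 0 < r) (hSa : ∀ z ∈ S, r ≤ ‖z - a‖)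
    (hSb : ∀ z ∈ S, r ≤ ‖z - b‖) (hm : ∀ z ∈ m, z ∈ S)
    (ha : ‖a - a'‖ ≤ r / (4 * (m.card + 1))) (hb : ‖b - b'‖ ≤ r / (4 * (m.card + 1)))
    (hprod : (m.map fun z => (z - a) / (z - b)).prod = 1)
    (hprod' : (m.map fun z => (z - a') / (z - b')).prod = 1) :
    HasBalancedLog S m a' b' := by
  obtain ⟨L, hL, hexp, hsum⟩ := h
  let f : ℂ → ℂ := fun z => Complex.log ((z - a') / (z - a)) - Complex.log ((z - b') / (z - b))
  have hr' : r / (4 * (m.card + 1)) ≤ r / 2 := by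
    have : (0 : ℝ) ≤ m.card := by positivity
    gcongr
    linarith
  have hne {c z : ℂ} (h : r ≤ ‖z - c‖) : z - c ≠ 0 := norm_pos_iff.1 (hr.trans_le h)
  have hne' {c c' z : ℂ} (h : r ≤ ‖z - c‖) (h' : ‖c - c'‖ ≤ r / (4 * (m.card + 1))) :
      z - c' ≠ 0 := by
    intro h0
    rw [sub_eq_zero.1 h0, norm_sub_rev] at h
    linarith
  have hf : ContinuousOn f S :=
    (Complex.continuousOn_log_sub_div_sub fun z hz =>
      ⟨sub_ne_zero.1 (hne (hSa z hz)), by linarith [hSa z hz]⟩).sub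
    (Complex.continuousOn_log_sub_div_sub fun z hz =>
      ⟨sub_ne_zero.1 (hne (hSb z hz)), by linarith [hSb z hz]⟩)
  have hfexp : ∀ z ∈ S, Complex.exp (f z) = ((z - a') / (z - b')) / ((z - a) / (z - b)) := by
    intro z hz
    have h1 := hne (hSa z hz)
    have h2 := hne (hSb z hz)
    have h3 := hne' (hSa z hz) ha
    have h4 := hne' (hSb z hz) hb
    rw [Complex.exp_sub, Complex.exp_log (div_ne_zero h3 h1), Complex.exp_log (div_ne_zero h4 h2)]
    field_simp
  have hfle : ∀ z ∈ S, ‖f z‖ ≤ 1 / (m.card + 1) := by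
    have key {c c' z : ℂ} (h : r ≤ ‖z - c‖) (h' : ‖c - c'‖ ≤ r / (4 * (m.card + 1))) :
        ‖Complex.log ((z - c') / (z - c))‖ ≤ 1 / 2 / (m.card + 1) := by
      calc _ ≤ 3 / 2 * (‖c - c'‖ / ‖z - c‖) :=
            Complex.norm_log_sub_div_sub_le (by linarith)
        _ ≤ 3 / 2 * (r / (4 * (m.card + 1)) / r) := by gcongr
        _ = 3 / 8 / (m.card + 1) := by field_simp; norm_num
        _ ≤ _ := by gcongr ?_ / _; norm_num
    intro z hz
    refine (norm_sub_le _ _).trans ((add_le_add (key (hSa z hz) ha) (key (hSb z hz) hb)).trans ?_)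
    rw [← add_div]
    norm_num
  have hfsum : (m.map f).sum = 0 := by
    have h1 : Complex.exp (m.map f).sum = 1 := by
      rw [Complex.exp_multiset_sum, Multiset.map_map,
        Multiset.map_congr (f := Complex.exp ∘ f)
          (g := fun z => ((z - a') / (z - b')) / ((z - a) / (z - b))) rfl
          fun z hz => hfexp z (hm z hz), Multiset.prod_map_div, hprod, hprod', div_one]
    have h2 : ‖(m.map f).sum‖ ≤ 1 := by
      calc _ ≤ (m.map fun z => ‖f z‖).sum := by
            simpa using norm_multiset_sum_le (m.map f)
        _ ≤ m.card • (1 / (m.card + 1 : ℝ)) := by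
          simpa using Multiset.sum_le_card_nsmul (m.map fun z => ‖f z‖) (1 / (m.card + 1))
            fun x hx => by
              obtain ⟨z, hz, rfl⟩ := Multiset.mem_map.1 hx
              exact hfle z (hm z hz)
        _ ≤ 1 := by
          rw [nsmul_eq_mul, mul_one_div, div_le_one (by positivity)]
          linarith
    obtain ⟨n, hn⟩ := Complex.exp_eq_one_iff.1 h1
    rcases eq_or_ne n 0 with rfl | hn0
    · simpa using hn
    · rw [hn] at h2
      have h3 : (1 : ℝ) ≤ |(n : ℝ)| := by exact_mod_cast Int.one_le_abs hn0
      have h4 : |(n : ℝ)| * (2 * Real.pi) ≤ 1 := by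
        simpa [abs_of_pos Real.pi_pos] using h2
      nlinarith [Real.pi_gt_three]
  refine ⟨L + f, hL.add hf, fun z hz => ?_, ?_⟩
  · rw [Pi.add_apply, Complex.exp_add, hexp z hz, hfexp z hz, mul_div_cancel₀]
    exact div_ne_zero (hne (hSa z hz)) (hne (hSb z hz))
  · simp only [Pi.add_apply, Multiset.sum_map_add, hsum, hfsum, add_zero]

/-- If `z ↦ (z - a) / (z - b)` has a balanced logarithm and `a`, `b` are far away, then `b / a` has
a small logarithm. -/
theorem HasBalancedLog.exists_exp_eq_div {S : Set ℂ} (hS : IsPreconnected S)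
    {m : Multiset ℂ} (hm : m ≠ 0) (hmS : ∀ z ∈ m, z ∈ S) {a b : ℂ} {R M : ℝ}
    (hSR : ∀ z ∈ S, ‖z‖ ≤ R)
    (hM : 0 < M) (hRM : R ≤ M / 2) (ha : M ≤ ‖a‖) (hb : M ≤ ‖b‖) (h : HasBalancedLog S m a b) :
    ∃ κ : ℂ, Complex.exp κ = b / a ∧ ‖κ‖ ≤ 3 * R / M := by
  obtain ⟨L, hL, hexp, hsum⟩ := h
  have hnorm {c z : ℂ} (hc : M ≤ ‖c‖) (hz : z ∈ S) : ‖-z / c‖ ≤ R / M := by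
    rw [norm_div, norm_neg]
    gcongr
    · exact (norm_nonneg z).trans (hSR z hz)
    · exact hSR z hz
  have hhalf : R / M ≤ 1 / 2 := by
    rw [div_le_iff₀ hM]
    linarith
  have hslit {c z : ℂ} (hc : M ≤ ‖c‖) (hz : z ∈ S) : 1 + -z / c ∈ Complex.slitPlane :=
    Complex.mem_slitPlane_of_norm_lt_one (by linarith [hnorm hc hz])
  have hcont {c : ℂ} (hc : M ≤ ‖c‖) : ContinuousOn (fun z => Complex.log (1 + -z / c)) S :=
    ContinuousOn.clog (by fun_prop) fun z hz => hslit hc hz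
  have hle {c z : ℂ} (hc : M ≤ ‖c‖) (hz : z ∈ S) :
      ‖Complex.log (1 + -z / c)‖ ≤ 3 / 2 * (R / M) :=
    (Complex.norm_log_one_add_half_le_self ((hnorm hc hz).trans hhalf)).trans
      (by gcongr; exact hnorm hc hz)
  have ha0 : a ≠ 0 := norm_pos_iff.1 (hM.trans_le ha)
  have hb0 : b ≠ 0 := norm_pos_iff.1 (hM.trans_le hb)
  let f : ℂ → ℂ := fun z => Complex.log (1 + -z / a) - Complex.log (1 + -z / b)
  have hfle : ∀ z ∈ S, ‖f z‖ ≤ 3 * R / M := fun z hz => by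
    refine (norm_sub_le _ _).trans ((add_le_add (hle ha hz) (hle hb hz)).trans_eq ?_)
    ring
  have hexp' : ∀ z ∈ S, Complex.exp (f z - L z) = b / a := by
    intro z hz
    have h1 := Complex.slitPlane_ne_zero (hslit ha hz)
    have h2 := Complex.slitPlane_ne_zero (hslit hb hz)
    have e1 : 1 + -z / a = -((z - a) / a) := by
      field_simp
      ring
    have e2 : 1 + -z / b = -((z - b) / b) := by
      field_simp
      ring
    rw [Complex.exp_sub, Complex.exp_sub, Complex.exp_log h1, Complex.exp_log h2, hexp z hz, e1, e2]
    rw [e1, neg_ne_zero] at h1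
    rw [e2, neg_ne_zero] at h2
    have h3 : z - a ≠ 0 := fun h => h1 (by simp [h])
    have h4 : z - b ≠ 0 := fun h => h2 (by simp [h])
    field_simp
  obtain ⟨x, hx⟩ := Multiset.exists_mem_of_ne_zero hm
  have hconst : ∀ z ∈ m, f z = L z + (f x - L x) := fun z hz => by
    have : f z - L z = f x - L x :=
      hS.eq_of_exp_eq_const (((hcont ha).sub (hcont hb)).sub hL) hexp' (hmS z hz) (hmS x hx)
    linear_combination this
  refine ⟨f x - L x, hexp' x (hmS x hx), ?_⟩
  have hsum' : (m.map f).sum = m.card * (f x - L x) := by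
    rw [Multiset.map_congr rfl hconst, Multiset.sum_map_add, hsum]
    simp
  have hcard : 0 < (m.card : ℝ) := by exact_mod_cast Multiset.card_pos.2 hm
  have hsumle : ‖(m.map f).sum‖ ≤ m.card * (3 * R / M) := by
    calc _ ≤ (m.map fun z => ‖f z‖).sum := by
          simpa using norm_multiset_sum_le (m.map f)
      _ ≤ m.card • (3 * R / M) := by
        simpa using Multiset.sum_le_card_nsmul (m.map fun z => ‖f z‖) (3 * R / M)
          fun y hy => by
            obtain ⟨z, hz, rfl⟩ := Multiset.mem_map.1 hy
            exact hfle z (hmS z hz)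
      _ = _ := nsmul_eq_mul _ _
  rw [hsum', norm_mul, Complex.norm_natCast] at hsumle
  exact le_of_mul_le_mul_left hsumle hcard

theorem IsClosed.exists_pos_forall_le_norm_sub {E : Type*} [NormedAddCommGroup E] {S : Set E}
    (hS : IsClosed S) {a : E} (ha : a ∉ S) : ∃ r > 0, ∀ z ∈ S, r ≤ ‖z - a‖ := by
  obtain ⟨r, hr, hball⟩ := Metric.mem_nhds_iff.1 (hS.isOpen_compl.mem_nhds ha)
  refine ⟨r, hr, fun z hz => ?_⟩
  by_contra! h
  exact hball (mem_ball_iff_norm.2 h) hz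

namespace Polynomial

/-- The divided difference `(p b - p a) / (b - a)`, extended by the derivative to the diagonal. -/
@[irreducible] noncomputable def dividedDiff (p : ℂ[X]) (a b : ℂ) : ℂ :=
  ∑ n ∈ Finset.range (p.natDegree + 1),
    p.coeff n * ∑ i ∈ Finset.range n, b ^ i * a ^ (n - 1 - i)

theorem continuous_dividedDiff (p : ℂ[X]) :
    Continuous fun x : ℂ × ℂ => p.dividedDiff x.1 x.2 := by
  unfold dividedDiff
  fun_prop

theorem dividedDiff_mul_sub (p : ℂ[X]) (a b : ℂ) :
    p.dividedDiff a b * (b - a) = p.eval b - p.eval a := by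
  rw [dividedDiff, eval_eq_sum_range, eval_eq_sum_range, Finset.sum_mul, ← Finset.sum_sub_distrib]
  exact Finset.sum_congr rfl fun n _ => by rw [mul_assoc, geom_sum₂_mul, mul_sub]

theorem dividedDiff_self (p : ℂ[X]) (a : ℂ) :
    p.dividedDiff a a = p.derivative.eval a := by
  rw [dividedDiff, derivative_eval, p.sum_over_range' (by simp) _ (Nat.lt_succ_self _)]
  refine Finset.sum_congr rfl fun n _ => ?_
  rw [mul_assoc, geom_sum₂_self]

theorem eval_divByMonic_X_sub_C (p : ℂ[X]) (a b : ℂ) :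
    (p /ₘ (X - C a)).eval b = p.dividedDiff a b := by
  have h (b : ℂ) : (p /ₘ (X - C a)).eval b * (b - a) = p.eval b - p.eval a := by
    have := congr_arg (eval b) (X_sub_C_mul_divByMonic_eq_sub_modByMonic p a)
    rw [modByMonic_X_sub_C_eq_C_eval] at this
    simpa [mul_comm] using this
  have hd : Continuous (p.dividedDiff a) :=
    p.continuous_dividedDiff.comp (Continuous.prodMk_right a)
  have he : EqOn (fun b => (p /ₘ (X - C a)).eval b) (p.dividedDiff a) {a}ᶜ := fun b hb =>
    mul_right_cancel₀ (sub_ne_zero.2 hb) ((h b).trans (p.dividedDiff_mul_sub a b).symm)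
  exact congr_fun (Continuous.ext_on (dense_compl_singleton a) (Polynomial.continuous _) hd he) b

theorem exists_root_norm_sub_lt {Q : ℂ[X]} {x : ℂ} {η : ℝ} (hη : 0 ≤ η)
    (h : ‖Q.eval x‖ < ‖Q.leadingCoeff‖ * η ^ Q.natDegree) : ∃ b, Q.eval b = 0 ∧ ‖x - b‖ < η := by
  by_contra! hcon
  have hs := IsAlgClosed.splits Q
  refine h.not_ge ?_
  rw [hs.eval_eq_prod_roots, norm_mul, hs.natDegree_eq_card_roots]
  gcongr
  have h1 : ‖(Q.roots.map fun b => x - b).prod‖ = (Q.roots.map fun b => ‖x - b‖).prod := by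
    simpa using map_multiset_prod (normHom : ℂ →*₀ ℝ) (Q.roots.map fun b => x - b)
  have h2 := Multiset.prod_map_le_prod_map₀ (s := Q.roots) (fun _ => η) (fun b => ‖x - b‖)
    (fun _ _ => hη) fun b hb => hcon b (isRoot_of_mem_roots hb)
  rw [h1]
  simpa using h2

theorem eventually_exists_dividedDiff_eq_zero {p : ℂ[X]} (hp : p.natDegree ≠ 0) {a b : ℂ}
    (hab : p.dividedDiff a b = 0) {η : ℝ} (hη : 0 < η) :
    ∀ᶠ a' in 𝓝 a, ∃ b', p.dividedDiff a' b' = 0 ∧ ‖b - b'‖ < η := by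
  have hp0 : p ≠ 0 := by rintro rfl; simp at hp
  have hdeg : (1 : WithBot ℕ) ≤ p.degree := by
    rw [degree_eq_natDegree hp0]
    exact_mod_cast Nat.one_le_iff_ne_zero.2 hp
  have hcont : Continuous fun a' => ‖p.dividedDiff a' b‖ :=
    (p.continuous_dividedDiff.comp (Continuous.prodMk_left b)).norm
  have hpos : 0 < ‖p.leadingCoeff‖ * η ^ (p.natDegree - 1) := by
    have := norm_pos_iff.2 (leadingCoeff_ne_zero.2 hp0)
    positivity
  have hev := hcont.continuousAt.eventually_lt (x₀ := a) continuousAt_const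
    (by simpa [hab] using hpos)
  filter_upwards [hev] with a' ha'
  obtain ⟨b', hb', hlt⟩ := exists_root_norm_sub_lt (Q := p /ₘ (X - C a')) (x := b) hη.le (by
    rwa [eval_divByMonic_X_sub_C, natDegree_divByMonic _ (monic_X_sub_C a'), natDegree_X_sub_C,
      leadingCoeff_divByMonic_of_monic (monic_X_sub_C a') (by simpa using hdeg)])
  exact ⟨b', by rwa [← eval_divByMonic_X_sub_C], hlt⟩

/-- If `|a|` is large, `p.dividedDiff a b` does not vanish for `b / a` near `1`. -/
theorem exists_dividedDiff_ne_zero {p : ℂ[X]} (hp : p.natDegree ≠ 0) :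
    ∃ ε > 0, ∀ a x : ℂ, 0 < ‖a‖ → ‖a‖⁻¹ < ε → ‖x - 1‖ < ε → p.dividedDiff a (a * x) ≠ 0 := by
  let Ψ : ℂ × ℂ → ℂ := fun v => ∑ n ∈ Finset.range (p.natDegree + 1),
    p.coeff n * (v.1 ^ (p.natDegree - n) * ∑ i ∈ Finset.range n, v.2 ^ i)
  have hΨ : Continuous Ψ := by fun_prop
  have hΨ0 : Ψ (0, 1) ≠ 0 := by
    have : Ψ (0, 1) = p.leadingCoeff * p.natDegree := by
      simp only [Ψ]
      rw [Finset.sum_eq_single p.natDegree]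
      · simp
      · intro n hn hne
        have : n < p.natDegree := by grind
        simp [zero_pow (Nat.sub_ne_zero_of_lt this)]
      · simp
    rw [this]
    simp only [ne_eq, mul_eq_zero, leadingCoeff_eq_zero, Nat.cast_eq_zero, hp, or_false]
    rintro rfl
    simp at hp
  obtain ⟨ε, hε, hball⟩ := Metric.eventually_nhds_iff.1 (hΨ.continuousAt.eventually_ne hΨ0)
  refine ⟨ε, hε, fun a x ha0 ha hx => ?_⟩
  have ha' : a ≠ 0 := norm_pos_iff.1 ha0
  have hne := hball (y := (a⁻¹, x)) (by simp [dist_eq_norm, ha, hx])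
  have : p.dividedDiff a (a * x) = a ^ (p.natDegree - 1) * Ψ (a⁻¹, x) := by
    simp only [dividedDiff, Ψ, Finset.mul_sum]
    refine Finset.sum_congr rfl fun n hn => Finset.sum_congr rfl fun i hi => ?_
    obtain ⟨k, hk⟩ : ∃ k, p.natDegree = n + k := Nat.exists_eq_add_of_le (by grind)
    obtain ⟨j, hj⟩ : ∃ j, n = i + 1 + j := Nat.exists_eq_add_of_le (by grind)
    rw [hk, hj]
    have e1 : i + 1 + j - 1 - i = j := by omega
    have e2 : i + 1 + j + k - 1 = i + j + k := by omega
    have e3 : i + 1 + j + k - (i + 1 + j) = k := by omega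
    rw [e1, e2, e3]
    rw [pow_add a, inv_pow, mul_pow, pow_add a]
    field_simp
  rw [this]
  exact mul_ne_zero (pow_ne_zero _ ha') hne

theorem eval_eq_eval_of_dividedDiff_eq_zero {p : ℂ[X]} {a b : ℂ} (h : p.dividedDiff a b = 0) :
    p.eval b = p.eval a := by
  have := p.dividedDiff_mul_sub a b
  rw [h, zero_mul] at this
  exact sub_eq_zero.1 this.symm

theorem prod_roots_sub_C_div {p : ℂ[X]} {v a b : ℂ} (hab : p.eval b = p.eval a)
    (ha : p.eval a ≠ v) : ((p - C v).roots.map fun z => (z - a) / (z - b)).prod = 1 := by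
  have h (x : ℂ) : (p - C v).eval x = _ := (IsAlgClosed.splits (p - C v)).eval_eq_prod_roots x
  have hne : (p - C v).eval a ≠ 0 := by simpa [sub_eq_zero] using ha
  have e (z : ℂ) : (z - a) / (z - b) = (a - z) / (b - z) := by
    rw [← neg_sub a z, ← neg_sub b z, neg_div_neg_eq]
  simp only [e, Multiset.prod_map_div]
  have hb : (p - C v).eval b = (p - C v).eval a := by simp [hab]
  have hne' := hne
  rw [h a] at hne'
  rw [h a, h b] at hb
  rw [mul_left_cancel₀ (left_ne_zero_of_mul hne') hb, div_self (right_ne_zero_of_mul hne')]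

/-- A simply connected open set whose preimage under `p` is connected contains all critical values
of `p`. -/
theorem eval_mem_of_isConnected_preimage {p : ℂ[X]} (hp : p.natDegree ≠ 0) {V : Set ℂ}
    (hV : IsSimplyConnected V) (hVo : IsOpen V) (hU : IsConnected (p.eval ⁻¹' V)) {c : ℂ}
    (hc : p.derivative.eval c = 0) : p.eval c ∈ V := by
  by_contra hcV
  obtain ⟨v, hv⟩ := hV.nonempty
  set m := (p - C v).roots with hm
  have hpv : p - C v ≠ 0 := by
    intro h
    rw [sub_eq_zero.1 h, natDegree_C] at hp
    exact hp rfl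
  have hmem {z : ℂ} : z ∈ m ↔ p.eval z = v := by
    simp [hm, mem_roots hpv, sub_eq_zero]
  have hUo : IsOpen (p.eval ⁻¹' V) := hVo.preimage p.continuous
  obtain ⟨z₀, hz₀⟩ := (p.isOpenQuotientMap_eval hp).surjective v
  obtain ⟨S, hSU, hmS, hSc, hSconn⟩ :=
    (hUo.isConnected_iff_isPathConnected.1 hU).exists_isCompact_isConnected
      (F := {z | z ∈ m}) (m.toFinset.finite_toSet.subset fun z hz => by simpa using hz)
      ⟨z₀, hmem.2 hz₀⟩ fun z hz => by
        rw [mem_preimage, hmem.1 hz]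
        exact hv
  set K := p.eval '' S
  have hKc : IsCompact K := hSc.image p.continuous
  have hKV : K ⊆ V := image_subset_iff.2 hSU
  have hvK : v ∈ K := ⟨z₀, hmS (hmem.2 hz₀), hz₀⟩
  have hcK : p.eval c ∉ K := fun h => hcV (hKV h)
  have hnotS {a : ℂ} (ha : p.eval a ∉ K) : a ∉ S := fun h => ha (mem_image_of_mem _ h)
  obtain ⟨L, hL, hLe⟩ := Complex.exists_continuousOn_eqOn_exp_comp hV hVo
    (g := fun z => z - p.eval c) (by fun_prop) (by
      rintro ⟨z, hz, h0⟩
      exact hcV (sub_eq_zero.1 h0 ▸ hz))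
  have hunb := hKc.not_isBounded_connectedComponentIn_compl hcK (hL.mono hKV)
    fun z hz => hLe (hKV hz)
  set G := connectedComponentIn Kᶜ (p.eval c)
  have hGo : IsOpen G := hKc.isClosed.isOpen_compl.connectedComponentIn
  have hGK : G ⊆ Kᶜ := connectedComponentIn_subset _ _
  let A : Set ℂ := {w | ∃ a b, p.eval a = w ∧ p.dividedDiff a b = 0 ∧ HasBalancedLog S m a b}
  have hperturb {a b a' b' : ℂ} {r : ℝ} (h : HasBalancedLog S m a b) (hr : 0 < r)
      (hSa : ∀ z ∈ S, r ≤ ‖z - a‖) (hSb : ∀ z ∈ S, r ≤ ‖z - b‖)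
      (ha : ‖a - a'‖ ≤ r / (4 * (m.card + 1))) (hb : ‖b - b'‖ ≤ r / (4 * (m.card + 1)))
      (haK : p.eval a ∉ K) (haK' : p.eval a' ∉ K) (hab : p.dividedDiff a b = 0)
      (hab' : p.dividedDiff a' b' = 0) : HasBalancedLog S m a' b' :=
    h.perturb hr hSa hSb hmS ha hb
      (prod_roots_sub_C_div (eval_eq_eval_of_dividedDiff_eq_zero hab)
        (ne_of_mem_of_not_mem hvK haK).symm)
      (prod_roots_sub_C_div (eval_eq_eval_of_dividedDiff_eq_zero hab')
        (ne_of_mem_of_not_mem hvK haK').symm)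
  have hfar {a b : ℂ} (haK : p.eval a ∉ K) (hab : p.dividedDiff a b = 0) :
      ∃ r > 0, (∀ z ∈ S, r ≤ ‖z - a‖) ∧ ∀ z ∈ S, r ≤ ‖z - b‖ := by
    obtain ⟨r₁, hr₁, h₁⟩ := hSc.isClosed.exists_pos_forall_le_norm_sub (hnotS haK)
    obtain ⟨r₂, hr₂, h₂⟩ := hSc.isClosed.exists_pos_forall_le_norm_sub
      (hnotS (eval_eq_eval_of_dividedDiff_eq_zero hab ▸ haK : p.eval b ∉ K))
    exact ⟨min r₁ r₂, lt_min hr₁ hr₂, fun z hz => (min_le_left _ _).trans (h₁ z hz),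
      fun z hz => (min_le_right _ _).trans (h₂ z hz)⟩
  have hAopen : IsOpen (A ∩ G) := by
    rw [isOpen_iff_mem_nhds]
    rintro w ⟨⟨a, b, rfl, hab, hlog⟩, haG⟩
    refine inter_mem ?_ (hGo.mem_nhds haG)
    obtain ⟨r, hr, hra, hrb⟩ := hfar (hGK haG) hab
    have hη : 0 < r / (4 * (m.card + 1)) := by positivity
    have h1 := eventually_exists_dividedDiff_eq_zero hp hab hη
    have h2 : ∀ᶠ a' in 𝓝 a, p.eval a' ∉ K :=
      p.continuous.continuousAt.eventually (hKc.isClosed.isOpen_compl.mem_nhds (hGK haG))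
    have h3 : ∀ᶠ a' in 𝓝 a, ‖a - a'‖ < r / (4 * (m.card + 1)) := by
      have : Continuous fun a' => ‖a - a'‖ := by fun_prop
      exact this.continuousAt.eventually_lt continuousAt_const (by simpa using hη)
    refine mem_of_superset ((p.isOpenQuotientMap_eval hp).isOpenMap.image_mem_nhds
      (h1.and (h2.and h3))) ?_
    rintro _ ⟨a', ⟨⟨b', hab', hb'⟩, haK', ha'⟩, rfl⟩
    exact ⟨a', b', rfl, hab', hperturb hlog hr hra hrb ha'.le hb'.le (hGK haG) haK' hab hab'⟩
  have hAclosed : closure (A ∩ G) ∩ G ⊆ A ∩ G := by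
    rintro w ⟨hw, hwG⟩
    refine ⟨?_, hwG⟩
    obtain ⟨u, hu, hulim⟩ := mem_closure_iff_seq_limit.1 hw
    choose a b hau hab hlog using fun n => (hu n).1
    have hproper := p.isProperMap_eval (natDegree_pos_iff_degree_pos.1 (Nat.pos_of_ne_zero hp))
    have hQ : IsCompact (p.eval ⁻¹' (insert w (range u))) :=
      hproper.isCompact_preimage hulim.isCompact_insert_range
    have hbdd := (hQ.prod hQ).isBounded
    obtain ⟨⟨a₀, b₀⟩, -, φ, hφ, hlim⟩ := tendsto_subseq_of_bounded hbdd
      (x := fun n => (a n, b n)) fun n => by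
        have h1 := eval_eq_eval_of_dividedDiff_eq_zero (hab n)
        refine ⟨?_, ?_⟩ <;> simp [h1, hau]
    have hlima : Tendsto (a ∘ φ) atTop (𝓝 a₀) := (continuous_fst.tendsto _).comp hlim
    have hlimb : Tendsto (b ∘ φ) atTop (𝓝 b₀) := (continuous_snd.tendsto _).comp hlim
    have ha₀ : p.eval a₀ = w := by
      refine tendsto_nhds_unique ((p.continuous.tendsto a₀).comp hlima) ?_
      convert hulim.comp hφ.tendsto_atTop using 1
      ext n
      simp [hau]
    have hab₀ : p.dividedDiff a₀ b₀ = 0 := by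
      refine tendsto_nhds_unique ((p.continuous_dividedDiff.tendsto _).comp hlim) ?_
      convert tendsto_const_nhds using 1
      ext n
      simp [hab]
    have hK₀ : p.eval a₀ ∉ K := ha₀ ▸ hGK hwG
    obtain ⟨r, hr, hra, hrb⟩ := hfar hK₀ hab₀
    have hη : 0 < r / 2 / (4 * (m.card + 1)) := by positivity
    have hηr : r / 2 / (4 * (m.card + 1)) ≤ r / 2 := by
      refine div_le_self (by positivity) ?_
      have : (0 : ℝ) ≤ m.card := by positivity
      linarith
    obtain ⟨n, hna, hnb⟩ := ((hlima.eventually (Metric.ball_mem_nhds _ hη)).and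
      (hlimb.eventually (Metric.ball_mem_nhds _ hη))).exists
    rw [dist_eq_norm] at hna hnb
    have hhalf {x y z : ℂ} (h : r ≤ ‖z - y‖) (h' : ‖x - y‖ ≤ r / 2) : r / 2 ≤ ‖z - x‖ := by
      have := norm_sub_le_norm_sub_add_norm_sub z x y
      linarith
    refine ⟨a₀, b₀, ha₀, hab₀, hperturb (hlog (φ n)) (half_pos hr)
      (fun z hz => hhalf (hra z hz) (hna.le.trans hηr))
      (fun z hz => hhalf (hrb z hz) (hnb.le.trans hηr)) hna.le hnb.le ?_ hK₀ (hab _) hab₀⟩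
    rw [hau]
    exact hGK (hu _).2
  have hGA : G ⊆ A ∩ G := by
    refine isPreconnected_connectedComponentIn.subset_of_closure_inter_subset hAopen ?_ hAclosed
    have hcG : p.eval c ∈ G := mem_connectedComponentIn hcK
    exact ⟨p.eval c, hcG, ⟨c, c, rfl, by rw [dividedDiff_self, hc],
      HasBalancedLog.refl (hnotS hcK)⟩, hcG⟩
  obtain ⟨ε, hε, hne⟩ := exists_dividedDiff_ne_zero hp
  obtain ⟨δ, hδ, hexp⟩ := Metric.continuousAt_iff.1
    (Complex.continuous_exp.continuousAt (x := 0)) ε hε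
  obtain ⟨R, hR0, hR⟩ := hSc.isBounded.exists_pos_norm_le
  obtain ⟨M, hM2, hMε, hMδ⟩ : ∃ M, 2 * R ≤ M ∧ ε⁻¹ < M ∧ 3 * R / δ < M :=
    ⟨max (2 * R) (max ε⁻¹ (3 * R / δ)) + 1, by
      refine ⟨?_, ?_, ?_⟩ <;> grind⟩
  have hM0 : 0 < M := by linarith
  obtain ⟨B, hB⟩ := ((isCompact_closedBall (0 : ℂ) M).image p.continuous).isBounded.exists_norm_le
  obtain ⟨w, hwG, hwB⟩ : ∃ w ∈ G, B < ‖w‖ := by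
    by_contra! h
    exact hunb (isBounded_iff_forall_norm_le.2 ⟨B, h⟩)
  obtain ⟨⟨a, b, rfl, hab, hlog⟩, -⟩ := hGA hwG
  have hlarge {x : ℂ} (hx : p.eval x = p.eval a) : M ≤ ‖x‖ := by
    by_contra! h
    have := hB _ (mem_image_of_mem _ (mem_closedBall_zero_iff.2 h.le))
    rw [hx] at this
    linarith
  obtain ⟨κ, hκ, hκle⟩ := hlog.exists_exp_eq_div hSconn.isPreconnected
    (m := m) (fun h => by simpa [h] using hmem.2 hz₀) hmS hR hM0 (by linarith) (hlarge rfl)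
    (hlarge (eval_eq_eval_of_dividedDiff_eq_zero hab))
  have ha0 : 0 < ‖a‖ := hM0.trans_le (hlarge rfl)
  refine hne a (b / a) ha0 ?_ ?_ (by rwa [mul_div_cancel₀ _ (norm_pos_iff.1 ha0)])
  · rw [inv_lt_comm₀ ha0 hε]
    exact hMε.trans_le (hlarge rfl)
  · rw [← hκ]
    have : dist κ 0 < δ := by
      rw [dist_zero_right]
      refine hκle.trans_lt ?_
      rwa [div_lt_comm₀ hM0 hδ]
    simpa [dist_eq_norm] using hexp this

end Polynomial

end

/-- Let `p` be a complex polynomial of degree `d ≥ 2`, and `U, V ⊆ ℂ` bounded,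
connected, simply connected open sets with `p⁻¹(V) = U`.  Then `p` has exactly
`d − 1` critical points in `U` counted with multiplicity; in particular `p` has no
critical points on `∂U` and no critical values on `∂V`. -/
theorem stmt_14 (p : Polynomial ℂ) (hp : 2 ≤ p.natDegree)
    (U V : Set ℂ)
    (hUb : Bornology.IsBounded U) (hUconn : IsConnected U)
    (hUsc : SimplyConnectedSpace U) (hUo : IsOpen U)
    (hVb : Bornology.IsBounded V) (hVconn : IsConnected V)
    (hVsc : SimplyConnectedSpace V) (hVo : IsOpen V)
    (hpre : (fun z => p.eval z) ⁻¹' V = U) :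
    Multiset.card (@Multiset.filter ℂ (· ∈ U) (Classical.decPred _)
        p.derivative.roots) = p.natDegree - 1 ∧
    (∀ z ∈ frontier U, p.derivative.eval z ≠ 0) ∧
    (∀ z : ℂ, p.derivative.eval z = 0 → p.eval z ∉ frontier V) := by
  have hsplit := IsAlgClosed.splits p.derivative
  have hdeg : p.natDegree ≠ 0 := by omega
  have hval : ∀ z, p.derivative.eval z = 0 → p.eval z ∈ V := fun z hz =>
    eval_mem_of_isConnected_preimage hdeg hVsc hVo (hpre ▸ hUconn) hz
  have hmem : ∀ z, p.derivative.eval z = 0 → z ∈ U := fun z hz => hpre ▸ hval z hz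
  refine ⟨?_, fun z hz h0 => ?_, fun z hz hfr => ?_⟩
  · let _ := Classical.decPred (· ∈ U)
    rw [Multiset.filter_eq_self.2 fun z hz => hmem z (isRoot_of_mem_roots hz),
      ← hsplit.natDegree_eq_card_roots, natDegree_derivative]
  · exact (hUo.frontier_eq ▸ hz).2 (hmem z h0)
  · exact (hVo.frontier_eq ▸ hfr).2 (hval z hz)
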